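/- Fix n ≥ 1 and c ∈ [0,1) with cn ∈ ℕ. Let P ∈ (ℝ²)ⁿ be a profile with a minimizer o(P) = (x_o, y_o) of C^u(·, P) satisfying x_o > 0 and y_o > 0, such that CMP(P, o(P), c) = (0,0), and suppose there are two agents i ≠ j with p_i ≠ p_j whose points both lie on the same closed half-axis (both in {(t,0) : t ≥ 0}, or both in {(t,0) : t ≤ 0}, or both in {(0,t) : t ≥ 0}, or both in {(0,t) : t ≤ 0}). Then there exists a profile Q of n points and a minimizer o(Q) of C^u(·, Q) such that C^u(CMP(Q, o(Q), c), Q) / C^u(o(Q), Q) > C^u(CMP(P, o(P), c), P) / C^u(o(P), P). Moreover, if instead CMP(P, (0,0), c) = (0,0) (with the other hypotheses unchanged), there exists a profile Q of n points with C^u(CMP(Q, (0,0), c), Q) / OPT^u(Q) > C^u(CMP(P, (0,0), c), P) / OPT^u(P). -/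

import Mathlib

/-- Euclidean distance on the plane. -/
noncomputable def eudist (a b : ℝ × ℝ) : ℝ :=
  Real.sqrt ((a.1 - b.1) ^ 2 + (a.2 - b.2) ^ 2)

/-- Utilitarian social cost: the average distance from `y` to the points of `P`. -/
noncomputable def Cu {n : ℕ} (y : ℝ × ℝ) (P : Fin n → ℝ × ℝ) : ℝ :=
  (∑ i, eudist y (P i)) / n

/-- The lower median of a multiset of `m` reals: its `⌈m/2⌉`-th smallest element. -/
noncomputable def lowerMedian (s : Multiset ℝ) : ℝ :=
  (s.sort (· ≤ ·)).getD ((s.card + 1) / 2 - 1) 0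

/-- The Coordinatewise Median with Predictions mechanism: the coordinatewise
lower median of the reported points together with `k` copies of the
prediction (where `k = c·n` for confidence `c`). -/
noncomputable def CMP {n : ℕ} (P : Fin n → ℝ × ℝ) (oh : ℝ × ℝ) (k : ℕ) : ℝ × ℝ :=
  (lowerMedian ((↑(List.ofFn fun i => (P i).1) : Multiset ℝ) + Multiset.replicate k oh.1),
   lowerMedian ((↑(List.ofFn fun i => (P i).2) : Multiset ℝ) + Multiset.replicate k oh.2))

lemma eudist_nonneg (a b : ℝ × ℝ) : 0 ≤ eudist a b := Real.sqrt_nonneg _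

lemma eudist_sq (a b : ℝ × ℝ) : eudist a b ^ 2 = (a.1 - b.1) ^ 2 + (a.2 - b.2) ^ 2 :=
  Real.sq_sqrt (by positivity)

lemma eudist_swap (a b : ℝ × ℝ) : eudist a.swap b.swap = eudist a b := by
  simp [eudist, add_comm]

lemma eudist_triangle (a b c : ℝ × ℝ) : eudist a c ≤ eudist a b + eudist b c := by
  have key : ∀ u v : ℝ × ℝ, eudist u v = ‖(⟨u.1, u.2⟩ - ⟨v.1, v.2⟩ : ℂ)‖ := by
    intro u v
    simp [eudist, Complex.norm_eq_sqrt_sq_add_sq]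
  rw [key, key, key]
  exact norm_sub_le_norm_sub_add_norm_sub _ _ _

lemma eudist_pos_of_ne {a b : ℝ × ℝ} (h : a ≠ b) : 0 < eudist a b := by
  refine Real.sqrt_pos.2 ?_
  by_contra! hle
  refine h (Prod.ext ?_ ?_) <;> nlinarith [sq_nonneg (a.1 - b.1), sq_nonneg (a.2 - b.2)]

lemma eudist_comm (a b : ℝ × ℝ) : eudist a b = eudist b a := by
  unfold eudist; congr 1; ring

lemma inner_le_sqrt_mul_sqrt (a b c d : ℝ) : a * c + b * d ≤ √(a ^ 2 + b ^ 2) * √(c ^ 2 + d ^ 2) := by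
  rw [← Real.sqrt_mul (by positivity)]
  apply Real.le_sqrt_of_sq_le
  nlinarith [sq_nonneg (a * d - b * c)]

/-! ### Pointwise comparison of the distances to the origin and to a location `(u, v)` -/

lemma eudist_zero_le_add_mul (τ : ℝ) (o p : ℝ × ℝ) :
    eudist (0, 0) p ≤ eudist (0, 0) o + √(1 + τ ^ 2) * eudist o p := by
  have h1 := eudist_triangle (0, 0) o p
  have h2 : 1 ≤ √(1 + τ ^ 2) := Real.one_le_sqrt.2 (by nlinarith [sq_nonneg τ])
  nlinarith [eudist_nonneg o p]

lemma eudist_zero_le_of_fst_nonpos {τ u v : ℝ} (hu : 0 ≤ u) {p : ℝ × ℝ}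
    (hv : 0 ≤ v) (hp : p.1 ≤ 0) :
    eudist (0, 0) p ≤ v - τ * u + √(1 + τ ^ 2) * eudist (u, v) p := by
  have h1 := eudist_triangle (0, 0) (0, v) p
  have h2 : eudist (0, 0) (0, v) = v := by simp [eudist, Real.sqrt_sq hv]
  have h3 : eudist (0, v) p + τ * u ≤ √(1 + τ ^ 2) * eudist (u, v) p := by
    have hc := inner_le_sqrt_mul_sqrt 1 τ (eudist (0, v) p) u
    rw [one_pow, eudist_sq] at hc
    have : √((((0 : ℝ), v).1 - p.1) ^ 2 + (((0 : ℝ), v).2 - p.2) ^ 2 + u ^ 2) ≤ eudist (u, v) p := by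
      apply Real.sqrt_le_sqrt
      simp only
      nlinarith
    nlinarith [Real.sqrt_nonneg (1 + τ ^ 2), mul_le_mul_of_nonneg_left this (Real.sqrt_nonneg (1 + τ ^ 2))]
  linarith

lemma eudist_zero_le_of_snd_nonpos {τ u v : ℝ} (hu : 0 ≤ u) {p : ℝ × ℝ}
    (hv : 0 ≤ v) (hp : p.2 ≤ 0) :
    eudist (0, 0) p ≤ u - τ * v + √(1 + τ ^ 2) * eudist (u, v) p := by
  have h := eudist_zero_le_of_fst_nonpos hv (τ := τ) (p := p.swap) hu hp
  have h1 := eudist_swap (0, 0) p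
  have h2 := eudist_swap (u, v) p
  simp only [Prod.swap_prod_mk] at h1 h2
  rwa [h1, h2] at h

lemma eudist_zero_add_le_of_nonpos {τ u v : ℝ} (hu : 0 ≤ u) (huv : u ≤ v)
    {p : ℝ × ℝ} (hp1 : p.1 ≤ 0) (hp2 : p.2 ≤ 0) :
    eudist (0, 0) p + u + τ * v ≤ √(1 + τ ^ 2) * eudist (u, v) p := by
  have hN := eudist_nonneg (0, 0) p
  have hNs := eudist_sq (0, 0) p
  have hds := eudist_sq (u, v) p
  set N := eudist (0, 0) p
  set d := eudist (u, v) p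
  simp only at hNs hds
  have hρ : √(1 + τ ^ 2) ^ 2 = 1 + τ ^ 2 := Real.sq_sqrt (by positivity)
  apply le_of_sq_le_sq _ (mul_nonneg (Real.sqrt_nonneg _) (eudist_nonneg _ _))
  rw [mul_pow, hρ, hds]
  have hNle : N ≤ -p.1 - p.2 := by
    apply le_of_sq_le_sq _ (by linarith)
    nlinarith [mul_nonneg_of_nonpos_of_nonpos hp1 hp2]
  have h1 : N * u ≤ -p.1 * u - p.2 * v := by nlinarith
  nlinarith [sq_nonneg (τ * N - (v - τ * u)), mul_nonneg (sq_nonneg τ) (sub_nonneg.2 h1)]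

lemma eudist_zero_add_lt_of_nonpos {τ u v : ℝ} (hu : 0 < u) (hv : 0 < v)
    {p : ℝ × ℝ} (hp1 : p.1 ≤ 0) (hp2 : p.2 ≤ 0) :
    eudist (0, 0) p + τ * eudist (0, 0) (u, v) < √(1 + τ ^ 2) * eudist (u, v) p := by
  have hN := eudist_nonneg (0, 0) p
  have hNs := eudist_sq (0, 0) p
  have hds := eudist_sq (u, v) p
  have hM := eudist_nonneg (0, 0) (u, v)
  have hMs := eudist_sq (0, 0) (u, v)
  set N := eudist (0, 0) p
  set M := eudist (0, 0) (u, v)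
  set d := eudist (u, v) p
  simp only at hNs hds hMs
  have hρ : √(1 + τ ^ 2) ^ 2 = 1 + τ ^ 2 := Real.sq_sqrt (by positivity)
  apply lt_of_pow_lt_pow_left₀ 2 (mul_nonneg (Real.sqrt_nonneg _) (eudist_nonneg _ _))
  rw [mul_pow, hρ]
  have h1 : d ^ 2 = N ^ 2 + M ^ 2 + 2 * (-p.1 * u + -p.2 * v) := by rw [hds, hNs, hMs]; ring
  have h2 : 0 ≤ -p.1 * u := by nlinarith
  have h3 : 0 ≤ -p.2 * v := by nlinarith
  rcases hN.eq_or_lt with h0 | h0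
  · rw [h1, ← h0]
    have : 0 < M ^ 2 := by rw [hMs]; nlinarith [mul_pos hu hu, sq_nonneg v]
    nlinarith [mul_nonneg (sq_nonneg τ) (add_nonneg h2 h3)]
  · have h4 : 0 < -p.1 * u + -p.2 * v := by
      by_contra! h5
      have : p.1 = 0 := by
        have : p.1 * u = 0 := by linarith
        exact (mul_eq_zero.1 this).resolve_right hu.ne'
      have : p.2 = 0 := by
        have : p.2 * v = 0 := by linarith
        exact (mul_eq_zero.1 this).resolve_right hv.ne'
      nlinarith
    rw [h1]
    nlinarith [sq_nonneg (τ * N - M), mul_nonneg (sq_nonneg τ) h4.le]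

/-! ### Summation of pointwise bounds depending on the signs of the coordinates -/

/-- The number of points of `P` satisfying `A`, as a real number. -/
noncomputable def numPts {n : ℕ} (P : Fin n → ℝ × ℝ) (A : ℝ × ℝ → Prop) [DecidablePred A] : ℝ :=
  ∑ i, if A (P i) then 1 else 0

lemma sum_le_of_sign_bound {n : ℕ} (P : Fin n → ℝ × ℝ) (f : ℝ × ℝ → ℝ) {r K a b : ℝ}
    (ha : 0 ≤ a) (hb : 0 ≤ b)
    (hx : r ≤ numPts P (fun p => p.1 ≤ 0)) (hy : r ≤ numPts P (fun p => p.2 ≤ 0))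
    (hf : ∀ p, f p ≤ K - a * (if p.1 ≤ 0 then 1 else 0) - b * (if p.2 ≤ 0 then 1 else 0)) :
    ∑ i, f (P i) ≤ n * K - r * (a + b) := by
  have h := Finset.sum_le_sum fun i (_ : i ∈ Finset.univ) => hf (P i)
  rw [Finset.sum_sub_distrib, Finset.sum_sub_distrib, ← Finset.mul_sum, ← Finset.mul_sum] at h
  simp only [Finset.sum_const, Finset.card_univ, Fintype.card_fin, nsmul_eq_mul] at h
  have h1 := mul_le_mul_of_nonneg_left hx ha
  have h2 := mul_le_mul_of_nonneg_left hy hb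
  unfold numPts at h1 h2
  linarith

lemma sum_add_le_of_sign_bound {n : ℕ} (P : Fin n → ℝ × ℝ) (f : ℝ × ℝ → ℝ) {r K a b e : ℝ}
    (ha : 0 ≤ a) (hb : 0 ≤ b)
    (hx : r ≤ numPts P (fun p => p.1 ≤ 0)) (hy : r ≤ numPts P (fun p => p.2 ≤ 0))
    (hf : ∀ p, f p ≤ K - a * (if p.1 ≤ 0 then 1 else 0) - b * (if p.2 ≤ 0 then 1 else 0))
    (i : Fin n) (hi : f (P i) + e ≤
      K - a * (if (P i).1 ≤ 0 then 1 else 0) - b * (if (P i).2 ≤ 0 then 1 else 0)) :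
    ∑ i, f (P i) + e ≤ n * K - r * (a + b) := by
  have h : ∑ j, (f (P j) + if j = i then e else 0) ≤ ∑ j,
      (K - a * (if (P j).1 ≤ 0 then 1 else 0) - b * (if (P j).2 ≤ 0 then 1 else 0)) := by
    refine Finset.sum_le_sum fun j _ => ?_
    by_cases hj : j = i
    · subst hj; simpa using hi
    · simpa [hj] using hf (P j)
  rw [Finset.sum_sub_distrib, Finset.sum_sub_distrib, ← Finset.mul_sum, ← Finset.mul_sum,
    Finset.sum_add_distrib] at h
  simp only [Finset.sum_const, Finset.card_univ, Fintype.card_fin, nsmul_eq_mul,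
    Finset.sum_ite_eq', Finset.mem_univ, if_true] at h
  have h1 := mul_le_mul_of_nonneg_left hx ha
  have h2 := mul_le_mul_of_nonneg_left hy hb
  unfold numPts at h1 h2
  linarith

lemma sign_bound_of_le_one {τ u v : ℝ} (hu : 0 ≤ u) (huv : u ≤ v) (hτ : τ ≤ 1) (p : ℝ × ℝ) :
    eudist (0, 0) p - √(1 + τ ^ 2) * eudist (u, v) p ≤ ((2 - τ) * u + v)
      - 2 * u * (if p.1 ≤ 0 then 1 else 0)
      - ((1 - τ) * u + (1 + τ) * v) * (if p.2 ≤ 0 then 1 else 0) := by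
  have hv : 0 ≤ v := hu.trans huv
  by_cases h1 : p.1 ≤ 0 <;> by_cases h2 : p.2 ≤ 0 <;> simp only [h1, h2, if_true, if_false]
  · linarith [eudist_zero_add_le_of_nonpos (τ := τ) hu huv h1 h2]
  · linarith [eudist_zero_le_of_fst_nonpos (τ := τ) hu hv h1]
  · linarith [eudist_zero_le_of_snd_nonpos (τ := τ) hu hv h2]
  · have h3 := eudist_zero_le_add_mul τ (u, v) p
    have h4 : eudist (0, 0) (u, v) ≤ u + v := by
      apply le_of_sq_le_sq _ (by positivity)
      rw [eudist_sq]; simp only; nlinarith [mul_nonneg hu hv]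
    nlinarith [mul_nonneg (sub_nonneg.2 hτ) hu]

section Bounds

variable {n : ℕ} (P : Fin n → ℝ × ℝ)

lemma sum_eudist_swap (o : ℝ × ℝ) :
    ∑ i, eudist o (P i).swap = ∑ i, eudist o.swap (P i) :=
  Finset.sum_congr rfl fun i _ => by rw [← eudist_swap, Prod.swap_swap]

lemma sum_eudist_zero_lt_of_lt {r s u v : ℝ} (hs : 0 ≤ s) (hsr : s < r) (hn : (n : ℝ) = s + r)
    (hu : 0 < u) (hv : 0 < v)
    (hx : r ≤ numPts P (fun p => p.1 ≤ 0)) (hy : r ≤ numPts P (fun p => p.2 ≤ 0)) :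
    ∑ i, eudist (0, 0) (P i) < √(1 + (s / r) ^ 2) * ∑ i, eudist (u, v) (P i) := by
  wlog huv : u ≤ v generalizing P u v
  · have h := this (fun i => (P i).swap) hv hu hy hx (le_of_not_ge huv)
    rwa [sum_eudist_swap, sum_eudist_swap] at h
  have hr : 0 < r := hs.trans_lt hsr
  set σ := s / r with hσ
  have hσ1 : σ < 1 := (div_lt_one hr).2 hsr
  have hσ0 : 0 ≤ σ := div_nonneg hs hr.le
  have hsσ : s = σ * r := by rw [hσ]; field_simp
  have h := sum_le_of_sign_bound P (fun p => eudist (0, 0) p - √(1 + σ ^ 2) * eudist (u, v) p)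
    (by positivity) (by nlinarith) hx hy (sign_bound_of_le_one hu.le huv hσ1.le)
  rw [Finset.sum_sub_distrib, ← Finset.mul_sum, hn] at h
  have h2 : 0 < r * (1 - σ) ^ 2 * u := by
    have := sub_pos.2 hσ1
    positivity
  rw [hsσ] at h
  nlinarith

lemma sum_eudist_zero_lt_of_gt {r s u v : ℝ} (hr : 0 < r) (hsr : r < s) (hn : (n : ℝ) = s + r)
    (hu : 0 < u) (hv : 0 < v)
    (hx : r ≤ numPts P (fun p => p.1 ≤ 0)) (hy : r ≤ numPts P (fun p => p.2 ≤ 0)) :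
    ∑ i, eudist (0, 0) (P i) < √(1 + (s / r) ^ 2) * ∑ i, eudist (u, v) (P i) := by
  set σ := s / r with hσ
  have hσ1 : 1 < σ := (one_lt_div hr).2 hsr
  have hsσ : s = σ * r := by rw [hσ]; field_simp
  set M := eudist (0, 0) (u, v) with hM
  have hM0 : 0 ≤ M := eudist_nonneg _ _
  have hMs : M ^ 2 = u ^ 2 + v ^ 2 := by rw [hM, eudist_sq]; ring
  have hMu : u ≤ M := by nlinarith
  have hMv : v ≤ M := by nlinarith
  have hMuv : M < u + v := by nlinarith [mul_pos hu hv]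
  set η := (σ - 1) * (u + v - M) / 2 with hη
  have hη0 : 0 < η := by
    have := sub_pos.2 hσ1
    have := sub_pos.2 hMuv
    positivity
  have hηu : η ≤ σ * u := by nlinarith
  have hηv : η ≤ σ * v := by nlinarith
  obtain ⟨i, hi⟩ : ∃ i, (P i).1 ≤ 0 := by
    by_contra! hall
    have : numPts P (fun p => p.1 ≤ 0) = 0 :=
      Finset.sum_eq_zero fun i _ => if_neg (hall i).not_ge
    linarith
  have key : ∀ p : ℝ × ℝ, eudist (0, 0) p - √(1 + σ ^ 2) * eudist (u, v) p ≤
      M - (M - v + σ * u - η) * (if p.1 ≤ 0 then 1 else 0)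
        - (M - u + σ * v - η) * (if p.2 ≤ 0 then 1 else 0) := by
    intro p
    by_cases h1 : p.1 ≤ 0 <;> by_cases h2 : p.2 ≤ 0 <;> simp only [h1, h2, if_true, if_false]
    · have := eudist_zero_add_lt_of_nonpos (τ := σ) hu hv h1 h2
      linarith
    · linarith [eudist_zero_le_of_fst_nonpos (τ := σ) hu.le hv.le h1]
    · linarith [eudist_zero_le_of_snd_nonpos (τ := σ) hu.le hv.le h2]
    · linarith [eudist_zero_le_add_mul σ (u, v) p]
  have keyi : ∃ e > 0, eudist (0, 0) (P i) - √(1 + σ ^ 2) * eudist (u, v) (P i) + e ≤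
      M - (M - v + σ * u - η) * (if (P i).1 ≤ 0 then 1 else 0)
        - (M - u + σ * v - η) * (if (P i).2 ≤ 0 then 1 else 0) := by
    by_cases h2 : (P i).2 ≤ 0 <;> simp only [hi, h2, if_true, if_false]
    · have := eudist_zero_add_lt_of_nonpos (τ := σ) hu hv hi h2
      exact ⟨_, sub_pos.2 this, by linarith⟩
    · exact ⟨η, hη0, by linarith [eudist_zero_le_of_fst_nonpos (τ := σ) hu.le hv.le hi]⟩
  obtain ⟨e, he, keyi⟩ := keyi
  have h := sum_add_le_of_sign_bound P
    (fun p => eudist (0, 0) p - √(1 + σ ^ 2) * eudist (u, v) p)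
    (by linarith) (by linarith) hx hy key i keyi
  rw [Finset.sum_sub_distrib, ← Finset.mul_sum, hn, hsσ] at h
  nlinarith

/-- Two distinct points on a common closed half-axis. -/
def HalfAxisPair (p q : ℝ × ℝ) : Prop :=
  p ≠ q ∧ ((p.2 = 0 ∧ q.2 = 0 ∧ 0 ≤ p.1 ∧ 0 ≤ q.1) ∨ (p.2 = 0 ∧ q.2 = 0 ∧ p.1 ≤ 0 ∧ q.1 ≤ 0) ∨
    (p.1 = 0 ∧ q.1 = 0 ∧ 0 ≤ p.2 ∧ 0 ≤ q.2) ∨ (p.1 = 0 ∧ q.1 = 0 ∧ p.2 ≤ 0 ∧ q.2 ≤ 0))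

lemma eudist_zero_lt_of_pos_axis {u v t : ℝ} (ht : 0 ≤ t) (hne : t ≠ u + v) :
    eudist (0, 0) (t, 0) < u - v + √2 * eudist (u, v) (t, 0) := by
  have h1 : eudist (0, 0) (t, 0) = t := by simp [eudist, Real.sqrt_sq ht]
  have h2 : t - u + v < √2 * eudist (u, v) (t, 0) := by
    apply lt_of_pow_lt_pow_left₀ 2 (mul_nonneg (Real.sqrt_nonneg _) (eudist_nonneg _ _))
    rw [mul_pow, Real.sq_sqrt (by norm_num), eudist_sq]
    have : 0 < (t - (u + v)) ^ 2 := by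
      have := sub_ne_zero.2 hne
      positivity
    simp only
    nlinarith
  linarith

/-- On a half-axis, only one point can be extremal for the ratio `√2`, unless it lies in the
closed third quadrant. -/
lemma HalfAxisPair.exists_nonextremal {p q : ℝ × ℝ} (h : HalfAxisPair p q) (u v : ℝ) :
    ∃ w, (w = p ∨ w = q) ∧ ((w.1 ≤ 0 ∧ w.2 ≤ 0) ∨
      (0 < w.1 ∧ w.2 ≤ 0 ∧ eudist (0, 0) w < u - v + √2 * eudist (u, v) w) ∨
      (w.1 ≤ 0 ∧ 0 < w.2 ∧ eudist (0, 0) w < v - u + √2 * eudist (u, v) w)) := by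
  obtain ⟨p1, p2⟩ := p
  obtain ⟨q1, q2⟩ := q
  obtain ⟨hne, h⟩ := h
  have hsw : ∀ t, 0 ≤ t → t ≠ u + v → eudist (0, 0) (0, t) < v - u + √2 * eudist (u, v) (0, t) := by
    intro t ht hne
    have := eudist_zero_lt_of_pos_axis (u := v) ht (by rwa [add_comm])
    rw [← eudist_swap (0, 0), ← eudist_swap (u, v)]
    exact this
  rcases h with h | h | h | h <;> simp only at h <;> obtain ⟨rfl, rfl, h1, h2⟩ := h
  · rcases h1.eq_or_lt with rfl | h1
    · exact ⟨_, Or.inl rfl, by simp⟩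
    rcases h2.eq_or_lt with rfl | h2
    · exact ⟨_, Or.inr rfl, by simp⟩
    by_cases hp : p1 = u + v
    · refine ⟨_, Or.inr rfl, Or.inr (Or.inl ⟨h2, le_rfl, eudist_zero_lt_of_pos_axis h2.le ?_⟩)⟩
      rintro rfl
      exact hne (by rw [hp])
    · exact ⟨_, Or.inl rfl, Or.inr (Or.inl ⟨h1, le_rfl, eudist_zero_lt_of_pos_axis h1.le hp⟩)⟩
  · exact ⟨_, Or.inl rfl, Or.inl ⟨h1, le_rfl⟩⟩
  · rcases h1.eq_or_lt with rfl | h1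
    · exact ⟨_, Or.inl rfl, by simp⟩
    rcases h2.eq_or_lt with rfl | h2
    · exact ⟨_, Or.inr rfl, by simp⟩
    by_cases hp : p2 = u + v
    · refine ⟨_, Or.inr rfl, Or.inr (Or.inr ⟨le_rfl, h2, hsw _ h2.le ?_⟩)⟩
      rintro rfl
      exact hne (by rw [hp])
    · exact ⟨_, Or.inl rfl, Or.inr (Or.inr ⟨le_rfl, h1, hsw _ h1.le hp⟩)⟩
  · exact ⟨_, Or.inl rfl, Or.inl ⟨le_rfl, h1⟩⟩

lemma sum_eudist_zero_lt_of_eq {r u v : ℝ} (hn : (n : ℝ) = r + r) (hu : 0 < u) (hv : 0 < v)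
    (hx : r ≤ numPts P (fun p => p.1 ≤ 0)) (hy : r ≤ numPts P (fun p => p.2 ≤ 0))
    {i j : Fin n} (hij : HalfAxisPair (P i) (P j)) :
    ∑ i, eudist (0, 0) (P i) < √2 * ∑ i, eudist (u, v) (P i) := by
  have h2 : √(1 + 1 ^ 2) = √2 := by norm_num
  set M := eudist (0, 0) (u, v) with hM
  have hM0 : 0 ≤ M := eudist_nonneg _ _
  have hMs : M ^ 2 = u ^ 2 + v ^ 2 := by rw [hM, eudist_sq]; ring
  have hMu : u ≤ M := by nlinarith
  have hMv : v ≤ M := by nlinarith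
  have hMuv : M < u + v := by nlinarith [mul_pos hu hv]
  set K := (M + u + v) / 2 with hK
  have third : ∀ p : ℝ × ℝ, p.1 ≤ 0 → p.2 ≤ 0 →
      eudist (0, 0) p - √2 * eudist (u, v) p + (u + v - K) ≤ -K := by
    intro p h1 h2'
    rcases le_total u v with huv | huv
    · linarith [h2 ▸ eudist_zero_add_le_of_nonpos (τ := 1) hu.le huv h1 h2']
    · have h3 := eudist_zero_add_le_of_nonpos (τ := 1) (p := p.swap) hv.le huv h2' h1
      have h4 := eudist_swap (0, 0) p
      have h5 := eudist_swap (u, v) p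
      simp only [Prod.swap_prod_mk] at h4 h5
      rw [h2, h4, h5] at h3
      linarith
  have key : ∀ p : ℝ × ℝ, eudist (0, 0) p - √2 * eudist (u, v) p ≤
      K - (K - v + u) * (if p.1 ≤ 0 then 1 else 0)
        - (K - u + v) * (if p.2 ≤ 0 then 1 else 0) := by
    intro p
    by_cases h1 : p.1 ≤ 0 <;> by_cases h2' : p.2 ≤ 0 <;> simp only [h1, h2', if_true, if_false]
    · linarith [third p h1 h2']
    · linarith [h2 ▸ eudist_zero_le_of_fst_nonpos (τ := 1) hu.le hv.le h1]
    · linarith [h2 ▸ eudist_zero_le_of_snd_nonpos (τ := 1) hu.le hv.le h2']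
    · linarith [h2 ▸ eudist_zero_le_add_mul 1 (u, v) p]
  obtain ⟨m, e, he, hm⟩ : ∃ m, ∃ e > 0, eudist (0, 0) (P m) - √2 * eudist (u, v) (P m) + e ≤
      K - (K - v + u) * (if (P m).1 ≤ 0 then 1 else 0)
        - (K - u + v) * (if (P m).2 ≤ 0 then 1 else 0) := by
    obtain ⟨w, hw, h⟩ := hij.exists_nonextremal u v
    obtain ⟨m, rfl⟩ : ∃ m, P m = w := by
      rcases hw with rfl | rfl
      exacts [⟨i, rfl⟩, ⟨j, rfl⟩]
    rcases h with h | h | h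
    · exact ⟨m, u + v - K, by linarith, by
        simp only [h.1, h.2, if_true]; linarith [third _ h.1 h.2]⟩
    · exact ⟨m, _, sub_pos.2 h.2.2, by simp only [h.1.not_ge, h.2.1, if_true, if_false]; linarith⟩
    · exact ⟨m, _, sub_pos.2 h.2.2, by simp only [h.1, h.2.1.not_ge, if_true, if_false]; linarith⟩
  have h := sum_add_le_of_sign_bound P (fun p => eudist (0, 0) p - √2 * eudist (u, v) p)
    (by linarith) (by linarith) hx hy key m hm
  rw [Finset.sum_sub_distrib, ← Finset.mul_sum, hn] at h
  nlinarith

lemma sum_eudist_zero_lt {r s u v : ℝ} (hs : 0 ≤ s) (hr : 0 < r) (hn : (n : ℝ) = s + r)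
    (hu : 0 < u) (hv : 0 < v)
    (hx : r ≤ numPts P (fun p => p.1 ≤ 0)) (hy : r ≤ numPts P (fun p => p.2 ≤ 0))
    {i j : Fin n} (hij : HalfAxisPair (P i) (P j)) :
    ∑ i, eudist (0, 0) (P i) < √(1 + (s / r) ^ 2) * ∑ i, eudist (u, v) (P i) := by
  rcases lt_trichotomy s r with h | rfl | h
  · exact sum_eudist_zero_lt_of_lt P hs h hn hu hv hx hy
  · have := sum_eudist_zero_lt_of_eq P hn hu hv hx hy hij
    rw [div_self hr.ne']
    norm_num at this ⊢
    exact this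
  · exact sum_eudist_zero_lt_of_gt P hr h hn hu hv hx hy

/-! ### Consequences of the optimality of a location in the open first quadrant -/

lemma eudist_sub_fst_lt {u v h : ℝ} (hh : 0 < h) (hu : h ≤ u) {p : ℝ × ℝ} (hp : p.1 ≤ 0) :
    eudist (u - h, v) p < eudist (u, v) p := by
  apply lt_of_pow_lt_pow_left₀ 2 (eudist_nonneg _ _)
  rw [eudist_sq, eudist_sq]
  simp only
  nlinarith

lemma eudist_sub_diag_lt {u v h : ℝ} (hh : 0 < h) (hu : h ≤ u) {p : ℝ × ℝ}
    (hp : p.1 ≤ 0) : eudist (u - h, v - h) p < eudist (u, v) p + h := by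
  have h1 := eudist_triangle (u - h, v - h) (u - h, v) p
  have h2 : eudist (u - h, v - h) (u - h, v) = h := by simp [eudist, Real.sqrt_sq hh.le]
  linarith [eudist_sub_fst_lt (v := v) hh hu hp]

lemma eudist_sub_diag_add_lt {u v h : ℝ} (hh : 0 < h) (hu : h ≤ u) (hv : h ≤ v) {p : ℝ × ℝ}
    (hp1 : p.1 ≤ 0) (hp2 : p.2 ≤ 0) : eudist (u - h, v - h) p + h < eudist (u, v) p := by
  have hd := eudist_nonneg (u - h, v - h) p
  have hds := eudist_sq (u - h, v - h) p
  apply lt_of_pow_lt_pow_left₀ 2 (eudist_nonneg _ _)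
  rw [eudist_sq (u, v)]
  set d := eudist (u - h, v - h) p
  simp only at hds ⊢
  have h1 : d ≤ (u - h - p.1) + (v - h - p.2) := by
    apply le_of_sq_le_sq _ (by linarith)
    nlinarith [mul_nonneg (show 0 ≤ u - h - p.1 by linarith) (show 0 ≤ v - h - p.2 by linarith)]
  nlinarith

lemma lt_three_mul_of_isMin {r s u v : ℝ} (hr : 0 < r) (hn : (n : ℝ) = s + r)
    (hu : 0 < u) (hv : 0 < v)
    (hx : r ≤ numPts P (fun p => p.1 ≤ 0)) (hy : r ≤ numPts P (fun p => p.2 ≤ 0))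
    (hmin : ∀ y, ∑ i, eudist (u, v) (P i) ≤ ∑ i, eudist y (P i)) : r < 3 * s := by
  obtain ⟨h, hh, hhu, hhv⟩ : ∃ h > 0, h ≤ u ∧ h ≤ v :=
    ⟨min u v, lt_min hu hv, min_le_left _ _, min_le_right _ _⟩
  obtain ⟨i, hi⟩ : ∃ i, (P i).1 ≤ 0 := by
    by_contra! hall
    have : numPts P (fun p => p.1 ≤ 0) = 0 :=
      Finset.sum_eq_zero fun i _ => if_neg (hall i).not_ge
    linarith
  have swap_diag : ∀ p : ℝ × ℝ, p.2 ≤ 0 → eudist (u - h, v - h) p < eudist (u, v) p + h := by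
    intro p hp
    have h3 := eudist_sub_diag_lt (v := u) hh hhv (p := p.swap) hp
    have h4 := eudist_swap (u - h, v - h) p
    have h5 := eudist_swap (u, v) p
    simp only [Prod.swap_prod_mk] at h4 h5
    rwa [h4, h5] at h3
  have key : ∀ p : ℝ × ℝ, eudist (u - h, v - h) p - eudist (u, v) p ≤
      3 * h - 2 * h * (if p.1 ≤ 0 then 1 else 0) - 2 * h * (if p.2 ≤ 0 then 1 else 0) := by
    intro p
    by_cases h1 : p.1 ≤ 0 <;> by_cases h2 : p.2 ≤ 0 <;> simp only [h1, h2, if_true, if_false]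
    · linarith [eudist_sub_diag_add_lt hh hhu hhv h1 h2]
    · linarith [eudist_sub_diag_lt (v := v) hh hhu h1]
    · linarith [swap_diag p h2]
    · have h1 := eudist_triangle (u - h, v - h) (u, v) p
      have h2 : eudist (u - h, v - h) (u, v) ≤ 3 * h := by
        apply le_of_sq_le_sq _ (by positivity)
        rw [eudist_sq]
        simp only
        nlinarith
      linarith
  obtain ⟨e, he, hie⟩ : ∃ e > 0, eudist (u - h, v - h) (P i) - eudist (u, v) (P i) + e ≤
      3 * h - 2 * h * (if (P i).1 ≤ 0 then 1 else 0)
        - 2 * h * (if (P i).2 ≤ 0 then 1 else 0) := by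
    by_cases h2 : (P i).2 ≤ 0 <;> simp only [hi, h2, if_true, if_false]
    · exact ⟨_, sub_pos.2 (eudist_sub_diag_add_lt hh hhu hhv hi h2), by linarith⟩
    · exact ⟨_, sub_pos.2 (eudist_sub_diag_lt (v := v) hh hhu hi), by linarith⟩
  have hsum := sum_add_le_of_sign_bound P (fun p => eudist (u - h, v - h) p - eudist (u, v) p)
    (by positivity) (by positivity) hx hy key i hie
  rw [Finset.sum_sub_distrib, hn] at hsum
  have := hmin (u - h, v - h)
  nlinarith

lemma eudist_sub_fst_add_le {u v : ℝ} (hu : 0 < u) {p : ℝ × ℝ} (hp : p.1 ≤ 0)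
    (hang : 71 / 100 * eudist (u, v) p ≤ u - p.1) :
    eudist (u - u / 10, v) p + 67 / 100 * (u / 10) ≤ eudist (u, v) p := by
  have hd := eudist_nonneg (u, v) p
  have hds := eudist_sq (u, v) p
  have hds' := eudist_sq (u - u / 10, v) p
  have hlt := eudist_sub_fst_lt (u := u) (v := v) (h := u / 10) (by positivity) (by linarith) hp
  have hd' := eudist_nonneg (u - u / 10, v) p
  set d := eudist (u, v) p
  set d' := eudist (u - u / 10, v) p
  simp only at hds hds'
  -- `d² - d'²` factors, and `d' ≤ d`
  have h1 : (d - d') * (d + d') = u / 10 * (2 * (u - p.1) - u / 10) := by nlinarith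
  have h2 : 67 / 100 * (2 * d) ≤ 2 * (u - p.1) - u / 10 := by nlinarith
  nlinarith

/-- A point of the third quadrant seen from `(u, v)` under a steep angle contributes little. -/
lemma eudist_zero_add_le_of_steep {u v ρ : ℝ} (hu : 0 < u) (hv : 0 < v) (hρ : 107 / 100 ≤ ρ)
    {p : ℝ × ℝ} (hp1 : p.1 ≤ 0) (hp2 : p.2 ≤ 0)
    (hang : u - p.1 ≤ 71 / 100 * eudist (u, v) p) :
    eudist (0, 0) p + 45 / 100 * v ≤ ρ * eudist (u, v) p := by
  have hd := eudist_nonneg (u, v) p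
  have hds := eudist_sq (u, v) p
  have hNs := eudist_sq (0, 0) p
  set d := eudist (u, v) p
  set N := eudist (0, 0) p
  simp only at hds hNs
  set X := u - p.1 with hX
  set Y := v - p.2 with hY
  have hYv : v ≤ Y := by linarith
  have hdY : Y ≤ d := by nlinarith
  have hYd : 704 / 1000 * d ≤ Y := by nlinarith
  suffices h : N + 45 / 100 * v ≤ 107 / 100 * d by nlinarith
  suffices h : N ≤ 107 / 100 * d - 45 / 100 * v by linarith
  apply le_of_sq_le_sq _ (by linarith)
  have hN2 : N ^ 2 ≤ X ^ 2 + (Y - v) ^ 2 := by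
    rw [hNs]; nlinarith
  have : X ^ 2 = d ^ 2 - Y ^ 2 := by linarith
  have hq : 0 ≤ 1449 / 10000 * d ^ 2 + v * (2 * Y - 963 / 1000 * d) - 7975 / 10000 * v ^ 2 := by
    rcases le_total d (71 / 50 * v) with h | h
    · nlinarith
    · nlinarith
  nlinarith

lemma sum_eudist_zero_lt_of_five {u v τ : ℝ} (hn : n = 7) (hu : 0 < u) (hv : 0 < v)
    (hτ : τ = 39 / 100)
    (hx : 5 ≤ numPts P (fun p => p.1 ≤ 0)) (hy : 5 ≤ numPts P (fun p => p.2 ≤ 0))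
    (hmin : ∀ y, ∑ i, eudist (u, v) (P i) ≤ ∑ i, eudist y (P i)) :
    ∑ i, eudist (0, 0) (P i) < √(1 + τ ^ 2) * ∑ i, eudist (u, v) (P i) := by
  wlog huv : u ≤ v generalizing P u v
  · have h := this (fun i => (P i).swap) hv hu hy hx (fun y => by
      rw [sum_eudist_swap, sum_eudist_swap]; exact hmin _) (le_of_not_ge huv)
    rwa [sum_eudist_swap, sum_eudist_swap] at h
  have hρ : 107 / 100 ≤ √(1 + τ ^ 2) := by
    apply Real.le_sqrt_of_sq_le
    rw [hτ]; norm_num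
  have hn' : (n : ℝ) = 7 := by rw [hn]; norm_num
  obtain ⟨i, hi1, hi2, hi⟩ : ∃ i, (P i).1 ≤ 0 ∧ (P i).2 ≤ 0 ∧
      u - (P i).1 ≤ 71 / 100 * eudist (u, v) (P i) := by
    by_contra! hall
    have h := sum_le_of_sign_bound P (n := n)
      (fun p => if p.1 ≤ 0 ∧ p.2 ≤ 0 ∧ u - p.1 ≤ 71 / 100 * eudist (u, v) p then
        -(67 / 100 * (u / 10)) else eudist (u - u / 10, v) p - eudist (u, v) p)
      (r := 5) (K := u / 10 * (167 / 100)) (a := u / 10 * (167 / 100)) (b := u / 10 * (67 / 100))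
      (by positivity) (by positivity) hx hy ?_
    · have h0 : ∑ i, (if (P i).1 ≤ 0 ∧ (P i).2 ≤ 0 ∧ u - (P i).1 ≤ 71 / 100 * eudist (u, v) (P i)
          then -(67 / 100 * (u / 10)) else eudist (u - u / 10, v) (P i) - eudist (u, v) (P i)) =
          ∑ i, (eudist (u - u / 10, v) (P i) - eudist (u, v) (P i)) := by
        refine Finset.sum_congr rfl fun i _ => if_neg ?_
        rintro ⟨h1, h2, h3⟩
        exact absurd h3 (hall i h1 h2).not_ge
      rw [h0, Finset.sum_sub_distrib, hn'] at h
      linarith [hmin (u - u / 10, v)]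
    · intro p
      have hu10 : u / 10 ≤ u := by linarith
      have h3 : eudist (u - u / 10, v) p ≤ u / 10 + eudist (u, v) p := by
        have h4 := eudist_triangle (u - u / 10, v) (u, v) p
        have h5 : eudist (u - u / 10, v) (u, v) = u / 10 := by
          simp [eudist, Real.sqrt_sq (show 0 ≤ u / 10 by positivity)]
        linarith
      by_cases h1 : p.1 ≤ 0 <;> by_cases h2 : p.2 ≤ 0 <;>
        simp only [h1, h2, if_true, if_false, true_and, false_and]
      · split_ifs with h
        · linarith
        · linarith [eudist_sub_fst_add_le (v := v) hu h1 (not_le.1 h).le]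
      · linarith [eudist_sub_fst_lt (v := v) (show 0 < u / 10 by positivity) hu10 h1]
      · linarith
      · linarith
  have key := sign_bound_of_le_one (τ := τ) hu.le huv (by rw [hτ]; norm_num)
  have hie : eudist (0, 0) (P i) - √(1 + τ ^ 2) * eudist (u, v) (P i)
        + (45 / 100 * v - u - τ * v) ≤
      ((2 - τ) * u + v) - 2 * u * (if (P i).1 ≤ 0 then 1 else 0)
        - ((1 - τ) * u + (1 + τ) * v) * (if (P i).2 ≤ 0 then 1 else 0) := by
    simp only [hi1, hi2, if_true]
    linarith [eudist_zero_add_le_of_steep hu hv hρ hi1 hi2 hi]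
  have h := sum_add_le_of_sign_bound P
    (fun p => eudist (0, 0) p - √(1 + τ ^ 2) * eudist (u, v) p)
    (by positivity) (by subst hτ; positivity) hx hy key i hie
  rw [Finset.sum_sub_distrib, ← Finset.mul_sum, hn'] at h
  subst hτ
  linarith

end Bounds

/-! ### The lower median in terms of counting -/

lemma exists_sorted_getElem_eq_lowerMedian {m : Multiset ℝ} (hm : m ≠ 0) :
    ∃ l : List ℝ, (l : Multiset ℝ) = m ∧ l.Pairwise (· ≤ ·) ∧
      ∃ h : (m.card + 1) / 2 - 1 < l.length, lowerMedian m = l[(m.card + 1) / 2 - 1] := by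
  have hc : 0 < m.card := Multiset.card_pos.2 hm
  have hl : (m.sort (· ≤ ·)).length = m.card := Multiset.length_sort _
  have hlt : (m.card + 1) / 2 - 1 < (m.sort (· ≤ ·)).length := by omega
  refine ⟨m.sort (· ≤ ·), Multiset.sort_eq _ _, Multiset.pairwise_sort _ _, hlt, ?_⟩
  unfold lowerMedian
  rw [List.getD_eq_getElem _ _ hlt]

lemma List.Pairwise.lt_countP {l : List ℝ} (hl : l.Pairwise (· ≤ ·)) {i : ℕ} (hi : i < l.length)
    (A : ℝ → Bool) (hA : ∀ x ≤ l[i], A x) : i + 1 ≤ l.countP A := by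
  have h1 : (l.take (i + 1)).countP A = (l.take (i + 1)).length := by
    rw [List.countP_eq_length]
    intro a ha
    obtain ⟨j, hj, rfl⟩ := List.getElem_of_mem ha
    rw [List.getElem_take]
    rw [List.length_take] at hj
    exact hA _ (hl.rel_get_of_le (a := ⟨j, by omega⟩) (b := ⟨i, hi⟩) (by simp; omega))
  have h2 := (List.take_sublist (i + 1) l).countP_le (p := A)
  rw [h1, List.length_take] at h2
  omega

lemma List.Pairwise.countP_le {l : List ℝ} (hl : l.Pairwise (· ≤ ·)) {i : ℕ} (hi : i < l.length)
    (A : ℝ → Bool) (hA : ∀ x ≥ l[i], A x = false) : l.countP A ≤ i := by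
  have h1 : (l.drop i).countP A = 0 := by
    rw [List.countP_eq_zero]
    intro a ha
    obtain ⟨j, hj, rfl⟩ := List.getElem_of_mem ha
    rw [List.getElem_drop]
    rw [List.length_drop] at hj
    have := hA _ (hl.rel_get_of_le (a := ⟨i, hi⟩) (b := ⟨i + j, by omega⟩) (by simp))
    simpa using this
  have h2 : l.countP A = (l.take i).countP A + (l.drop i).countP A := by
    rw [← List.countP_append, List.take_append_drop]
  have h3 := (List.countP_le_length (p := A) (l := l.take i))
  rw [List.length_take] at h3
  omega

lemma le_countP_of_lowerMedian_eq {m : Multiset ℝ} (hm : m ≠ 0) {v : ℝ} (h : lowerMedian m = v) :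
    (m.card + 1) / 2 ≤ m.countP (· ≤ v) := by
  have hc : 0 < m.card := Multiset.card_pos.2 hm
  obtain ⟨l, hlm, hl, hi, hv⟩ := exists_sorted_getElem_eq_lowerMedian hm
  have := hl.lt_countP hi (fun x => decide (x ≤ v)) (by
    intro x hx; rw [← hv, h] at hx; simpa using hx)
  have h2 : m.countP (· ≤ v) = l.countP (fun x => decide (x ≤ v)) := by
    rw [← hlm, Multiset.coe_countP]
  omega

lemma lowerMedian_eq_of_countP {m : Multiset ℝ} {v : ℝ}
    (h1 : m.countP (· < v) < (m.card + 1) / 2) (h2 : (m.card + 1) / 2 ≤ m.countP (· ≤ v)) :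
    lowerMedian m = v := by
  have hm : m ≠ 0 := by rintro rfl; simp at h1
  obtain ⟨l, hlm, hl, hi, hv⟩ := exists_sorted_getElem_eq_lowerMedian hm
  have e1 : m.countP (· < v) = l.countP (fun x => decide (x < v)) := by
    rw [← hlm, Multiset.coe_countP]
  have e2 : m.countP (· ≤ v) = l.countP (fun x => decide (x ≤ v)) := by
    rw [← hlm, Multiset.coe_countP]
  rcases lt_trichotomy (lowerMedian m) v with h | h | h
  · have := hl.lt_countP hi (fun x => decide (x < v)) (by
      intro x hx; rw [← hv] at hx; simpa using hx.trans_lt h)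
    omega
  · exact h
  · have := hl.countP_le hi (fun x => decide (x ≤ v)) (by
      intro x hx; rw [← hv] at hx; simpa using h.trans_le hx)
    omega

lemma countP_ofFn_add_replicate {n : ℕ} (f : Fin n → ℝ) (t : ℝ) (k : ℕ) (A : ℝ → Prop)
    [DecidablePred A] :
    ((↑(List.ofFn f) : Multiset ℝ) + Multiset.replicate k t).countP A =
      (∑ i, if A (f i) then 1 else 0) + if A t then k else 0 := by
  rw [Multiset.countP_add]
  congr 1
  · rw [← Fin.univ_val_map, Multiset.countP_map, Finset.sum_boole]
    rfl
  · rw [← Multiset.coe_replicate, Multiset.coe_countP, List.countP_replicate]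
    simp

lemma le_count_of_lowerMedian_eq_zero {n : ℕ} (hn : 1 ≤ n) {f : Fin n → ℝ} {t : ℝ} {k : ℕ}
    (h : lowerMedian ((↑(List.ofFn f) : Multiset ℝ) + Multiset.replicate k t) = 0) :
    (n + k + 1) / 2 ≤ (∑ i, if f i ≤ 0 then 1 else 0) + if t ≤ 0 then k else 0 := by
  rw [← countP_ofFn_add_replicate f t k (· ≤ 0)]
  have := le_countP_of_lowerMedian_eq (fun h0 => ?_) h
  · simpa using this
  · have := congrArg Multiset.card h0
    simp at this
    omega

lemma lowerMedian_eq_zero_of_count {n : ℕ} {f : Fin n → ℝ} {t : ℝ} {k : ℕ}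
    (h1 : (∑ i, if f i < 0 then 1 else 0) + (if t < 0 then k else 0) < (n + k + 1) / 2)
    (h2 : (n + k + 1) / 2 ≤ (∑ i, if f i ≤ 0 then 1 else 0) + if t ≤ 0 then k else 0) :
    lowerMedian ((↑(List.ofFn f) : Multiset ℝ) + Multiset.replicate k t) = 0 := by
  apply lowerMedian_eq_of_countP
  · rw [countP_ofFn_add_replicate f t k (· < 0)]
    simpa using h1
  · rw [countP_ofFn_add_replicate f t k (· ≤ 0)]
    simpa using h2

/-! ### The extremal profiles -/

/-- A profile consisting of `s`, `p`, `q` copies of three given points. -/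
lemma exists_profile {n s p q : ℕ} (hn : n = s + p + q) (a b c : ℝ × ℝ) :
    ∃ Q : Fin n → ℝ × ℝ, ∀ (M : Type) [AddCommMonoid M] (F : ℝ × ℝ → M),
      ∑ i, F (Q i) = s • F a + p • F b + q • F c := by
  subst hn
  refine ⟨Fin.append (Fin.append (fun _ => a) (fun _ => b)) (fun _ => c), fun M _ F => ?_⟩
  simp [Fin.sum_univ_add]

/-- `Q` consists of `s` points at `(0, 1)`, `p` points at `(t, 0)` and `q` points at `(-t, 0)`. -/
def IsExtremal {n : ℕ} (Q : Fin n → ℝ × ℝ) (s p q : ℕ) (t : ℝ) : Prop :=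
  ∀ (M : Type) [AddCommMonoid M] (F : ℝ × ℝ → M),
    ∑ i, F (Q i) = s • F (0, 1) + p • F (t, 0) + q • F (-t, 0)

namespace IsExtremal

variable {n s p q : ℕ} {Q : Fin n → ℝ × ℝ} {t : ℝ}

lemma sum_zero (hQ : IsExtremal Q s p q t) (ht : 0 < t) :
    ∑ i, eudist (0, 0) (Q i) = s + (p + q) * t := by
  rw [hQ ℝ]
  simp [eudist, Real.sqrt_sq ht.le]
  ring

lemma sum_top (hQ : IsExtremal Q s p q t) :
    ∑ i, eudist (0, 1) (Q i) = (p + q) * √(1 + t ^ 2) := by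
  rw [hQ ℝ]
  simp [eudist, add_comm (t ^ 2)]
  ring

lemma CMP_eq_zero (hQ : IsExtremal Q s p q t) (ht : 0 < t) {k : ℕ} {y : ℝ} (hy : 0 ≤ y)
    (hq : q < (n + k + 1) / 2) (hp : (n + k + 1) / 2 ≤ s + q + k)
    (hpq : (n + k + 1) / 2 ≤ p + q + if y ≤ 0 then k else 0) : CMP Q (0, y) k = (0, 0) := by
  refine Prod.ext ?_ ?_ <;> apply lowerMedian_eq_zero_of_count
  · rw [hQ ℕ (fun w => if w.1 < 0 then 1 else 0)]
    simpa [ht, ht.not_gt, ht.le] using hq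
  · rw [hQ ℕ (fun w => if w.1 ≤ 0 then 1 else 0)]
    simpa [ht, ht.not_ge, ht.le] using hp
  · rw [hQ ℕ (fun w => if w.2 < 0 then 1 else 0)]
    have : ¬ (1 : ℝ) < 0 := by norm_num
    simp [hy.not_gt, this]
    omega
  · rw [hQ ℕ (fun w => if w.2 ≤ 0 then 1 else 0)]
    have : ¬ (1 : ℝ) ≤ 0 := by norm_num
    simpa [this] using hpq

lemma isMin (hQ : IsExtremal Q s p q t)
    (h : ((p : ℝ) - q) ^ 2 * t ^ 2 + (p + q) ^ 2 ≤ s ^ 2 * (1 + t ^ 2)) (y : ℝ × ℝ) :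
    ∑ i, eudist (0, 1) (Q i) ≤ ∑ i, eudist y (Q i) := by
  rw [hQ.sum_top, hQ ℝ]
  simp only [nsmul_eq_mul]
  set L := √(1 + t ^ 2) with hL
  have hL0 : 0 < L := Real.sqrt_pos.2 (by positivity)
  have hLs : L ^ 2 = 1 + t ^ 2 := Real.sq_sqrt (by positivity)
  have hr : t * (t - y.1) + 1 * y.2 ≤ L * eudist y (t, 0) := by
    have := inner_le_sqrt_mul_sqrt t 1 (t - y.1) y.2
    have e : eudist y (t, 0) = √((t - y.1) ^ 2 + y.2 ^ 2) := by
      simp only [eudist]; congr 1; ring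
    rwa [e, hL, add_comm (1 : ℝ), show t ^ 2 + 1 = t ^ 2 + 1 ^ 2 by ring]
  have hl : t * (t + y.1) + 1 * y.2 ≤ L * eudist y (-t, 0) := by
    have := inner_le_sqrt_mul_sqrt t 1 (t + y.1) y.2
    have e : eudist y (-t, 0) = √((t + y.1) ^ 2 + y.2 ^ 2) := by
      simp only [eudist]; congr 1; ring
    rwa [e, hL, add_comm (1 : ℝ), show t ^ 2 + 1 = t ^ 2 + 1 ^ 2 by ring]
  have hs : ((p : ℝ) - q) * t * y.1 + (p + q) * (1 - y.2) ≤ L * (s * eudist y (0, 1)) := by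
    have h1 := inner_le_sqrt_mul_sqrt (((p : ℝ) - q) * t) (p + q) y.1 (1 - y.2)
    have e : eudist y (0, 1) = √(y.1 ^ 2 + (1 - y.2) ^ 2) := by
      simp only [eudist]; congr 1; ring
    have h2 : √((((p : ℝ) - q) * t) ^ 2 + (p + q) ^ 2) ≤ s * L := by
      rw [Real.sqrt_le_left (by positivity), mul_pow, mul_pow, hLs]
      exact h
    rw [← e] at h1
    nlinarith [mul_le_mul_of_nonneg_right h2 (eudist_nonneg y (0, 1))]
  have hp0 : (0 : ℝ) ≤ p := Nat.cast_nonneg _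
  have hq0 : (0 : ℝ) ≤ q := Nat.cast_nonneg _
  refine le_of_mul_le_mul_left ?_ hL0
  nlinarith [mul_le_mul_of_nonneg_left hr hp0, mul_le_mul_of_nonneg_left hl hq0]

end IsExtremal

lemma extremal_ratio {s r : ℝ} (hs : 0 < s) (hr : 0 < r) :
    (s + r * (r / s)) / (r * √(1 + (r / s) ^ 2)) = √(1 + (s / r) ^ 2) := by
  have h1 : √(1 + (r / s) ^ 2) = r / s * √(1 + (s / r) ^ 2) := by
    rw [← Real.sqrt_sq (div_pos hr hs).le, ← Real.sqrt_mul (by positivity),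
      Real.sqrt_sq (div_pos hr hs).le]
    congr 1
    field_simp
    ring
  have h2 : √(1 + (s / r) ^ 2) ^ 2 = 1 + (s / r) ^ 2 := Real.sq_sqrt (by positivity)
  have h3 : 0 < √(1 + (s / r) ^ 2) := Real.sqrt_pos.2 (by positivity)
  rw [h1, div_eq_iff (by positivity)]
  have h4 : s + r * (r / s) = r * (r / s) * (1 + (s / r) ^ 2) := by field_simp; ring
  rw [h4]
  linear_combination -(r * (r / s)) * h2

lemma Cu_div_Cu {n : ℕ} (hn : 1 ≤ n) (P Q : Fin n → ℝ × ℝ) (a b : ℝ × ℝ) :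
    Cu a P / Cu b Q = (∑ i, eudist a (P i)) / ∑ i, eudist b (Q i) := by
  have : (n : ℝ) ≠ 0 := by positivity
  exact div_div_div_cancel_right₀ this _ _

lemma Cu_nonneg {n : ℕ} (a : ℝ × ℝ) (P : Fin n → ℝ × ℝ) : 0 ≤ Cu a P :=
  div_nonneg (Finset.sum_nonneg fun _ _ => eudist_nonneg _ _) (Nat.cast_nonneg _)

lemma bddBelow_range_Cu {n : ℕ} (P : Fin n → ℝ × ℝ) : BddBelow (Set.range fun y => Cu y P) :=
  ⟨0, by rintro _ ⟨y, rfl⟩; exact Cu_nonneg y P⟩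

lemma IsExtremal.iInf_Cu_pos {n s p q : ℕ} {Q : Fin n → ℝ × ℝ} {t : ℝ}
    (hQ : IsExtremal Q s p q t) (hn : 1 ≤ n) (hs : 1 ≤ s) (hp : 1 ≤ p) :
    0 < ⨅ y : ℝ × ℝ, Cu y Q := by
  have hc : 0 < eudist (0, 1) (t, 0) := eudist_pos_of_ne (by simp)
  refine (div_pos hc (show (0 : ℝ) < n by positivity)).trans_le (le_ciInf fun y => ?_)
  unfold Cu
  gcongr
  rw [hQ ℝ]
  simp only [nsmul_eq_mul]
  have h1 := eudist_triangle (0, 1) y (t, 0)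
  rw [eudist_comm (0, 1) y] at h1
  have hs' : (1 : ℝ) ≤ s := by exact_mod_cast hs
  have hp' : (1 : ℝ) ≤ p := by exact_mod_cast hp
  have hq' : (0 : ℝ) ≤ q := Nat.cast_nonneg _
  nlinarith [eudist_nonneg y (0, 1), eudist_nonneg y (t, 0),
    mul_nonneg hq' (eudist_nonneg y (-t, 0))]

lemma le_numPts {n m : ℕ} (P : Fin n → ℝ × ℝ) (A : ℝ × ℝ → Prop) [DecidablePred A]
    (h : m ≤ ∑ i, if A (P i) then 1 else 0) : (m : ℝ) ≤ numPts P A := by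
  unfold numPts
  exact_mod_cast h

lemma div_lt_of_lt_mul {A B w : ℝ} (hA : 0 ≤ A) (hw : 0 ≤ w) (h : A < w * B) : A / B < w := by
  have hB : 0 < B := by
    by_contra! hB
    nlinarith [mul_nonneg hw (neg_nonneg.2 hB)]
  rwa [div_lt_iff₀ hB]

lemma exists_consistency_profile {n k s r : ℕ} (hn : 1 ≤ n)
    (hr : r = (n + k + 1) / 2) (hs : n = s + r) (P : Fin n → ℝ × ℝ) {u v : ℝ}
    (hu : 0 < u) (hv : 0 < v) (hmin : ∀ y, ∑ i, eudist (u, v) (P i) ≤ ∑ i, eudist y (P i))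
    {i j : Fin n} (hij : HalfAxisPair (P i) (P j))
    (hx : r ≤ numPts P (fun p => p.1 ≤ 0)) (hy : r ≤ numPts P (fun p => p.2 ≤ 0)) :
    ∃ (Q : Fin n → ℝ × ℝ) (oQ : ℝ × ℝ), (∀ y : ℝ × ℝ, Cu oQ Q ≤ Cu y Q) ∧
      Cu (0, 0) P / Cu (u, v) P < Cu (CMP Q oQ k) Q / Cu oQ Q := by
  have hr0 : 1 ≤ r := by omega
  have hr' : (0 : ℝ) < r := by exact_mod_cast hr0
  have hns : (n : ℝ) = s + r := by exact_mod_cast hs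
  have h3 : r < 3 * s := by exact_mod_cast lt_three_mul_of_isMin P hr' hns hu hv hx hy hmin
  have hs0 : 1 ≤ s := by omega
  have hs' : (0 : ℝ) < s := by exact_mod_cast hs0
  have hA : 0 ≤ ∑ i, eudist (0, 0) (P i) := Finset.sum_nonneg fun _ _ => eudist_nonneg _ _
  have hpq : (r + 1) / 2 + r / 2 = r := by omega
  have hpq' : (((r + 1) / 2 : ℕ) : ℝ) + ((r / 2 : ℕ) : ℝ) = r := by exact_mod_cast hpq
  obtain ⟨t, ht, hbal, hlt⟩ : ∃ t : ℝ, 0 < t ∧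
      ((((r + 1) / 2 : ℕ) : ℝ) - ((r / 2 : ℕ) : ℝ)) ^ 2 * t ^ 2 + r ^ 2 ≤ s ^ 2 * (1 + t ^ 2) ∧
      Cu (0, 0) P / Cu (u, v) P < (s + r * t) / (r * √(1 + t ^ 2)) := by
    rw [Cu_div_Cu hn]
    by_cases h25 : s = 2 ∧ r = 5
    · obtain ⟨rfl, rfl⟩ := h25
      refine ⟨3, by norm_num, by norm_num, ?_⟩
      have h5 := sum_eudist_zero_lt_of_five P (by omega) hu hv rfl
        (by exact_mod_cast hx) (by exact_mod_cast hy) hmin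
      refine (div_lt_of_lt_mul hA (Real.sqrt_nonneg _) h5).trans_le ?_
      rw [le_div_iff₀ (by positivity), mul_left_comm, ← Real.sqrt_mul (by positivity)]
      have : √((1 + (39 / 100 : ℝ) ^ 2) * (1 + 3 ^ 2)) ≤ 17 / 5 := by
        rw [Real.sqrt_le_left (by norm_num)]; norm_num
      push_cast
      linarith
    · refine ⟨r / s, by positivity, ?_, ?_⟩
      · have e : (s : ℝ) ^ 2 * (1 + (r / s) ^ 2) = s ^ 2 + r ^ 2 := by field_simp
        rw [e]
        rcases Nat.even_or_odd r with ⟨a, ha⟩ | ⟨a, ha⟩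
        · have : (r + 1) / 2 = r / 2 := by omega
          rw [this, sub_self]
          nlinarith [sq_nonneg (s : ℝ)]
        · have : (r + 1) / 2 = r / 2 + 1 := by omega
          rw [this]
          have hrs : r ≤ s ^ 2 := by
            rcases (show s = 1 ∨ s = 2 ∨ 3 ≤ s by omega) with rfl | rfl | h
            · omega
            · omega
            · nlinarith
          have hrs' : (r : ℝ) / s ≤ s := by
            rw [div_le_iff₀ hs', ← sq]; exact_mod_cast hrs
          have : (0 : ℝ) ≤ r / s := by positivity
          push_cast
          nlinarith
      · rw [extremal_ratio hs' hr']
        exact div_lt_of_lt_mul hA (Real.sqrt_nonneg _)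
          (sum_eudist_zero_lt P hs'.le hr' hns hu hv hx hy hij)
  obtain ⟨Q, hQ⟩ := exists_profile (n := n) (s := s) (p := (r + 1) / 2) (q := r / 2)
    (by omega) (0, 1) (t, 0) (-t, 0)
  have hQ' : IsExtremal Q s ((r + 1) / 2) (r / 2) t := hQ
  refine ⟨Q, (0, 1), fun y => ?_, ?_⟩
  · unfold Cu
    have := hQ'.isMin (by rw [hpq']; exact hbal) y
    gcongr
  · rw [hQ'.CMP_eq_zero ht zero_le_one (by omega) (by omega) (by omega), Cu_div_Cu hn Q,
      hQ'.sum_zero ht, hQ'.sum_top, hpq']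
    exact hlt

lemma exists_robustness_profile {n k s r : ℕ} (hn : 2 ≤ n) (hk : k < n)
    (hr : r + k = (n + k + 1) / 2) (hs : n = s + r) (P : Fin n → ℝ × ℝ) {u v : ℝ}
    (hu : 0 < u) (hv : 0 < v) (hmin : ∀ y, Cu (u, v) P ≤ Cu y P)
    {i j : Fin n} (hij : HalfAxisPair (P i) (P j))
    (hx : r ≤ numPts P (fun p => p.1 ≤ 0)) (hy : r ≤ numPts P (fun p => p.2 ≤ 0)) :
    ∃ Q : Fin n → ℝ × ℝ, Cu (0, 0) P / (⨅ y : ℝ × ℝ, Cu y P) <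
      Cu (CMP Q (0, 0) k) Q / ⨅ y : ℝ × ℝ, Cu y Q := by
  have hr0 : 1 ≤ r := by omega
  have hs0 : 1 ≤ s := by omega
  have hr' : (0 : ℝ) < r := by exact_mod_cast hr0
  have hs' : (0 : ℝ) < s := by exact_mod_cast hs0
  have hns : (n : ℝ) = s + r := by exact_mod_cast hs
  have hpq' : (((r + 1) / 2 : ℕ) : ℝ) + ((r / 2 : ℕ) : ℝ) = r := by
    have hpq : (r + 1) / 2 + r / 2 = r := by omega
    exact_mod_cast hpq
  have ht : (0 : ℝ) < r / s := by positivity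
  obtain ⟨Q, hQ⟩ := exists_profile (n := n) (s := s) (p := (r + 1) / 2) (q := r / 2)
    (by omega) (0, 1) ((r : ℝ) / s, 0) (-((r : ℝ) / s), 0)
  have hQ' : IsExtremal Q s ((r + 1) / 2) (r / 2) (r / s) := hQ
  refine ⟨Q, ?_⟩
  have hinf : (⨅ y : ℝ × ℝ, Cu y P) = Cu (u, v) P :=
    le_antisymm (ciInf_le (bddBelow_range_Cu P) _) (le_ciInf hmin)
  rw [hinf, hQ'.CMP_eq_zero ht le_rfl (by omega) (by omega) (by simp; omega), Cu_div_Cu (by omega)]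
  calc _ < √(1 + ((s : ℝ) / r) ^ 2) :=
        div_lt_of_lt_mul (Finset.sum_nonneg fun _ _ => eudist_nonneg _ _) (Real.sqrt_nonneg _)
          (sum_eudist_zero_lt P hs'.le hr' hns hu hv hx hy hij)
    _ = Cu (0, 0) Q / Cu (0, 1) Q := by
        rw [Cu_div_Cu (by omega), hQ'.sum_zero ht, hQ'.sum_top, hpq', extremal_ratio hs' hr']
    _ ≤ _ := div_le_div_of_nonneg_left (Cu_nonneg _ _)
        (hQ'.iInf_Cu_pos (by omega) hs0 (by omega)) (ciInf_le (bddBelow_range_Cu Q) _)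

/-- if two distinct reported points lie on the same closed
half-axis while the optimal location is strictly inside the top-right quadrant
and CMP outputs the origin, then there is a profile with a strictly worse
approximation ratio (both for correct predictions and for prediction (0,0)). -/
theorem CMP_clustering_pair (n : ℕ) (hn : 1 ≤ n) (c : ℝ) (hc0 : 0 ≤ c) (hc1 : c < 1)
    (k : ℕ) (hk : (k : ℝ) = c * n)
    (P : Fin n → ℝ × ℝ) (xo yo : ℝ) (hxo : 0 < xo) (hyo : 0 < yo)
    (ho : ∀ y : ℝ × ℝ, Cu (xo, yo) P ≤ Cu y P)
    (i j : Fin n) (hij : i ≠ j) (hpij : P i ≠ P j)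
    (hax : ((P i).2 = 0 ∧ (P j).2 = 0 ∧ 0 ≤ (P i).1 ∧ 0 ≤ (P j).1) ∨
           ((P i).2 = 0 ∧ (P j).2 = 0 ∧ (P i).1 ≤ 0 ∧ (P j).1 ≤ 0) ∨
           ((P i).1 = 0 ∧ (P j).1 = 0 ∧ 0 ≤ (P i).2 ∧ 0 ≤ (P j).2) ∨
           ((P i).1 = 0 ∧ (P j).1 = 0 ∧ (P i).2 ≤ 0 ∧ (P j).2 ≤ 0)) :
    -- correct prediction (consistency version)
    (CMP P (xo, yo) k = (0, 0) →
      ∃ (Q : Fin n → ℝ × ℝ) (oQ : ℝ × ℝ), (∀ y : ℝ × ℝ, Cu oQ Q ≤ Cu y Q) ∧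
        Cu (CMP P (xo, yo) k) P / Cu (xo, yo) P <
          Cu (CMP Q oQ k) Q / Cu oQ Q) ∧
    -- prediction (0,0) (robustness version)
    (CMP P (0, 0) k = (0, 0) →
      ∃ Q : Fin n → ℝ × ℝ,
        Cu (CMP P (0, 0) k) P / (⨅ y : ℝ × ℝ, Cu y P) <
          Cu (CMP Q (0, 0) k) Q / ⨅ y : ℝ × ℝ, Cu y Q) := by
  have hkn : k < n := by
    have : (k : ℝ) < n := by
      have : (0 : ℝ) < n := by positivity
      rw [hk]; nlinarith
    exact_mod_cast this
  have hn2 : 2 ≤ n := by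
    by_contra! h
    exact hij (Fin.ext (by omega))
  have hpair : HalfAxisPair (P i) (P j) := ⟨hpij, hax⟩
  have hmin : ∀ y, ∑ i, eudist (xo, yo) (P i) ≤ ∑ i, eudist y (P i) := fun y =>
    (div_le_div_iff_of_pos_right (by positivity)).1 (ho y)
  refine ⟨fun h => ?_, fun h => ?_⟩
  · have hx := le_count_of_lowerMedian_eq_zero hn (Prod.ext_iff.1 h).1
    have hy := le_count_of_lowerMedian_eq_zero hn (Prod.ext_iff.1 h).2
    rw [if_neg hxo.not_ge, add_zero] at hx
    rw [if_neg hyo.not_ge, add_zero] at hy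
    rw [h]
    exact exists_consistency_profile (s := n - (n + k + 1) / 2) hn rfl (by omega) P hxo hyo
      hmin hpair (le_numPts P (fun p => p.1 ≤ 0) hx) (le_numPts P (fun p => p.2 ≤ 0) hy)
  · have hx := le_count_of_lowerMedian_eq_zero hn (Prod.ext_iff.1 h).1
    have hy := le_count_of_lowerMedian_eq_zero hn (Prod.ext_iff.1 h).2
    rw [if_pos le_rfl, ← Nat.sub_le_iff_le_add] at hx hy
    rw [h]
    exact exists_robustness_profile (s := n - ((n + k + 1) / 2 - k)) hn2 hkn (by omega) (by omega)
      P hxo hyo ho hpair (le_numPts P (fun p => p.1 ≤ 0) hx) (le_numPts P (fun p => p.2 ≤ 0) hy)
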